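/- Suppose labeled posets (P,ω) and (Q,τ) satisfy (P,ω) ~ (Q,τ), the underlying poset P has either exactly 2 or exactly 3 linear extensions, and |P| = |Q| ≥ 5. Then P and Q both have a unique minimal element, or P and Q both have a unique maximal element. -/

import Mathlib

/-- A labeling of a finite poset: a bijection onto `{1, …, n}`. -/
def IsLabeling {α : Type*} (ω : α → ℕ) : Prop :=
  Set.BijOn ω Set.univ (Set.Icc 1 (Nat.card α))

/-- `f` is a `(P,ω)`-partition. -/
def IsPtn {α : Type*} [PartialOrder α] (ω : α → ℕ) (f : α → ℕ) : Prop :=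
  (∀ a, 1 ≤ f a) ∧ (∀ a b : α, a ≤ b → f a ≤ f b) ∧
    (∀ a b : α, a ≤ b → ω b < ω a → f a < f b)

/-- The number of `(P,ω)`-partitions of weight `w`. -/
noncomputable def ptnCount {α : Type*} [PartialOrder α] (ω : α → ℕ) (w : ℕ →₀ ℕ) : ℕ :=
  Set.ncard {f : α → ℕ | IsPtn ω f ∧ ∀ m : ℕ, 1 ≤ m → (f ⁻¹' {m}).ncard = w m}

/-- `(P,ω) ~ (Q,τ)`: equality of the `(P,ω)`-partition generating functions. -/
def KEq {α β : Type*} [PartialOrder α] [PartialOrder β] (ω : α → ℕ) (τ : β → ℕ) : Prop :=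
  ∀ w : ℕ →₀ ℕ, ptnCount ω w = ptnCount τ w

/-- The number of linear extensions of the finite poset `α`: bijections
`e : α → {1,…,n}` such that `a < b` implies `e a < e b`. -/
noncomputable def linExtCount (α : Type*) [PartialOrder α] [Fintype α] : ℕ :=
  Set.ncard {e : α ≃ Fin (Fintype.card α) | ∀ a b : α, a < b → e a < e b}

/-- `f` is a linear extension of `α`, recorded as a function with values in `{1, …, |α|}`. -/
def IsLinExt {α : Type*} [PartialOrder α] [Fintype α] (f : α → ℕ) : Prop :=
  (∀ a b, a < b → f a < f b) ∧ Function.Injective f ∧ ∀ a, 1 ≤ f a ∧ f a ≤ Fintype.card α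

/-- The weight taking the value `1` on `{1, …, n}`. -/
noncomputable def onesWeight (n : ℕ) : ℕ →₀ ℕ :=
  Finsupp.onFinset (Finset.Icc 1 n) (fun m => if 1 ≤ m ∧ m ≤ n then 1 else 0)
    (by intro m hm; simp at hm ⊢; omega)

/-- The weight `(2, 1, …, 1)` of total mass `n`. -/
noncomputable def twoOnesWeight (n : ℕ) : ℕ →₀ ℕ :=
  Finsupp.onFinset (Finset.Icc 1 n)
    (fun m => if m = 1 ∧ 1 ≤ n then 2 else if 2 ≤ m ∧ m + 1 ≤ n then 1 else 0)
    (by intro m hm; simp at hm ⊢; grind)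

section LinExt

variable {α : Type*} [PartialOrder α] [Fintype α]

lemma IsLinExt.exists_eq {f : α → ℕ} (hf : IsLinExt f) {i : ℕ} (h1 : 1 ≤ i)
    (hi : i ≤ Fintype.card α) : ∃ a, f a = i := by
  have hsub : Finset.univ.image f ⊆ Finset.Icc 1 (Fintype.card α) := by
    intro m hm
    obtain ⟨a, -, rfl⟩ := Finset.mem_image.1 hm
    exact Finset.mem_Icc.2 (hf.2.2 a)
  have heq := Finset.eq_of_subset_of_card_le hsub (by
    rw [Finset.card_image_of_injective _ hf.2.1]; simp)
  have : i ∈ Finset.univ.image f := by rw [heq]; exact Finset.mem_Icc.2 ⟨h1, hi⟩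
  obtain ⟨a, -, ha⟩ := Finset.mem_image.1 this
  exact ⟨a, ha⟩

lemma setOf_isLinExt_subset_image :
    {f : α → ℕ | IsLinExt f} ⊆ (fun (e : α ≃ Fin (Fintype.card α)) (a : α) => (e a : ℕ) + 1) ''
      {e | ∀ a b : α, a < b → e a < e b} := by
  intro f hf
  have hlt : ∀ a, f a - 1 < Fintype.card α := fun a => by have := hf.2.2 a; omega
  have hinj : Function.Injective (fun a => (⟨f a - 1, hlt a⟩ : Fin (Fintype.card α))) := by
    intro a b hab
    apply hf.2.1
    have := hf.2.2 a
    have := hf.2.2 b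
    simp at hab
    omega
  have hbij := (Fintype.bijective_iff_injective_and_card _).2 ⟨hinj, by simp⟩
  refine ⟨Equiv.ofBijective _ hbij, ?_, ?_⟩
  · intro a b hab
    have := hf.1 a b hab
    have := hf.2.2 a
    simp [Fin.lt_def]
    omega
  · funext a
    have := hf.2.2 a
    simp
    omega

lemma finite_setOf_isLinExt : {f : α → ℕ | IsLinExt f}.Finite :=
  ((Set.toFinite _).image _).subset setOf_isLinExt_subset_image

lemma ncard_setOf_isLinExt_le : {f : α → ℕ | IsLinExt f}.ncard ≤ linExtCount α :=
  (Set.ncard_le_ncard setOf_isLinExt_subset_image ((Set.toFinite _).image _)).trans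
    (Set.ncard_image_le (Set.toFinite _))

lemma exists_isLinExt : ∃ f : α → ℕ, IsLinExt f := by
  have : Fintype (LinearExtension α) := inferInstanceAs (Fintype α)
  have hc : Fintype.card (LinearExtension α) = Fintype.card α := Fintype.card_congr (Equiv.refl _)
  let e := Fintype.orderIsoFinOfCardEq (LinearExtension α) hc
  have hm : Function.Injective (toLinearExtension : α → LinearExtension α) := fun a b h => h
  refine ⟨fun a => (e.symm (toLinearExtension a) : ℕ) + 1, ?_, ?_, ?_⟩
  · intro a b hab
    have h1 : toLinearExtension a < toLinearExtension b :=
      lt_of_le_of_ne (toLinearExtension.monotone hab.le) (fun h => hab.ne (hm h))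
    have := e.symm.strictMono h1
    simpa [Fin.lt_def] using this
  · intro a b hab
    simp at hab
    exact hm (e.symm.injective (Fin.ext hab))
  · intro a
    have := (e.symm (toLinearExtension a)).2
    dsimp only
    omega

/-- Moving a minimal element to the front of a linear extension. -/
lemma IsLinExt.moveFirst {f : α → ℕ} (hf : IsLinExt f) {z : α} (hz : IsMin z) :
    IsLinExt (fun a => if f a = f z then 1 else if f a < f z then f a + 1 else f a) := by
  have h5 := hf.2.2 z
  refine ⟨fun a b hab => ?_, fun a b hab => hf.2.1 ?_, fun a => ?_⟩
  · have h1 := hf.1 a b hab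
    have hb : f b ≠ f z := fun h => by
      rw [hf.2.1 h] at hab
      exact hz.not_lt hab
    have h2 := hf.2.2 a
    dsimp only
    split_ifs <;> omega
  · have h2 := hf.2.2 a
    have h6 := hf.2.2 b
    dsimp only at hab
    split_ifs at hab <;> omega
  · have h2 := hf.2.2 a
    dsimp only
    split_ifs <;> omega

/-- Moving a maximal element to the end of a linear extension. -/
lemma IsLinExt.moveLast {f : α → ℕ} (hf : IsLinExt f) {z : α} (hz : IsMax z) :
    IsLinExt (fun a => if f a = f z then Fintype.card α else if f z < f a then f a - 1 else f a) := by
  have h5 := hf.2.2 z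
  refine ⟨fun a b hab => ?_, fun a b hab => hf.2.1 ?_, fun a => ?_⟩
  · have h1 := hf.1 a b hab
    have hb : f a ≠ f z := fun h => by
      rw [hf.2.1 h] at hab
      exact hz.not_lt hab
    have h2 := hf.2.2 b
    dsimp only
    split_ifs <;> omega
  · have h2 := hf.2.2 a
    have h6 := hf.2.2 b
    dsimp only at hab
    split_ifs at hab <;> omega
  · have h2 := hf.2.2 a
    dsimp only
    split_ifs <;> omega

lemma exists_isLinExt_first_two {x y : α} (hx : IsMin x) (hy : IsMin y) (hxy : x ≠ y) :
    ∃ f : α → ℕ, IsLinExt f ∧ f x = 1 ∧ f y = 2 := by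
  obtain ⟨f, hf⟩ := exists_isLinExt (α := α)
  obtain ⟨g, hg, hgy⟩ : ∃ g : α → ℕ, IsLinExt g ∧ g y = 1 := ⟨_, hf.moveFirst hy, if_pos rfl⟩
  refine ⟨_, hg.moveFirst hx, if_pos rfl, ?_⟩
  have h2 := hg.2.2 x
  have h3 : g x ≠ g y := fun h => hxy (hg.2.1 h)
  split_ifs <;> omega

lemma exists_isLinExt_last_two {x y : α} (hx : IsMax x) (hy : IsMax y) (hxy : x ≠ y) :
    ∃ f : α → ℕ, IsLinExt f ∧ f x + 1 = Fintype.card α ∧ f y = Fintype.card α := by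
  obtain ⟨f, hf⟩ := exists_isLinExt (α := α)
  obtain ⟨g, hg, hgx⟩ : ∃ g : α → ℕ, IsLinExt g ∧ g x = Fintype.card α :=
    ⟨_, hf.moveLast hx, if_pos rfl⟩
  refine ⟨_, hg.moveLast hy, ?_, if_pos rfl⟩
  have h2 := hg.2.2 y
  have h3 : g x ≠ g y := fun h => hxy (hg.2.1 h)
  split_ifs <;> omega

lemma IsLinExt.swap {f : α → ℕ} (hf : IsLinExt f) {p q : α} (hpq : f q = f p + 1)
    (h : ¬ p < q) : IsLinExt (Equiv.swap (f p) (f q) ∘ f) := by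
  refine ⟨?_, (Equiv.injective _).comp hf.2.1, ?_⟩
  · intro a b hab
    have h1 := hf.1 a b hab
    have h2 : ¬ (f a = f p ∧ f b = f q) := by
      rintro ⟨ha, hb⟩
      rw [hf.2.1 ha, hf.2.1 hb] at hab
      exact h hab
    simp only [Function.comp, Equiv.swap_apply_def]
    grind
  · intro a
    have h1 := hf.2.2 a
    have h2 := hf.2.2 p
    have h3 := hf.2.2 q
    simp only [Function.comp, Equiv.swap_apply_def]
    grind

lemma four_le_ncard_isLinExt {f₁ f₂ f₃ f₄ : α → ℕ} (h₁ : IsLinExt f₁) (h₂ : IsLinExt f₂)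
    (h₃ : IsLinExt f₃) (h₄ : IsLinExt f₄) (h₁₂ : f₁ ≠ f₂) (h₁₃ : f₁ ≠ f₃) (h₁₄ : f₁ ≠ f₄)
    (h₂₃ : f₂ ≠ f₃) (h₂₄ : f₂ ≠ f₄) (h₃₄ : f₃ ≠ f₄) :
    4 ≤ {f : α → ℕ | IsLinExt f}.ncard := by
  classical
  have hsub : (({f₁, f₂, f₃, f₄} : Finset (α → ℕ)) : Set (α → ℕ)) ⊆ {f | IsLinExt f} := by
    intro f hf
    simp at hf
    rcases hf with rfl | rfl | rfl | rfl <;> assumption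
  have := Set.ncard_le_ncard hsub finite_setOf_isLinExt
  rw [Set.ncard_coe_finset] at this
  have hc : ({f₁, f₂, f₃, f₄} : Finset (α → ℕ)).card = 4 := by
    rw [Finset.card_insert_of_notMem (by simp [*]), Finset.card_insert_of_notMem (by simp [*]),
      Finset.card_pair h₃₄]
  omega

/-- With at most three linear extensions, a linear extension ending in two incomparable elements
`y`, `y'` lists the other elements in a chain, and its second element lies below `y`. -/
lemma IsLinExt.chain_of_ncard_le_three (hN : {f : α → ℕ | IsLinExt f}.ncard ≤ 3)
    (h5 : 5 ≤ Fintype.card α) {f : α → ℕ} (hf : IsLinExt f) {y y' : α}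
    (hy : f y + 1 = Fintype.card α) (hy' : f y' = Fintype.card α) (hyy : ¬ y < y') :
    (∀ a b, f a < f b → f b + 2 ≤ Fintype.card α → a < b) ∧ ∀ a, f a = 2 → a < y := by
  have hs := hf.swap (p := y) (q := y') (by omega) hyy
  have adj : ∀ a b, f b = f a + 1 → f b + 2 ≤ Fintype.card α → a < b := by
    intro a b hab hb
    by_contra hlt
    have h2 := hf.swap hab hlt
    have ea : (Equiv.swap (f y) (f y') ∘ f) a = f a := by
      simp only [Function.comp, Equiv.swap_apply_def]; grind
    have eb : (Equiv.swap (f y) (f y') ∘ f) b = f b := by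
      simp only [Function.comp, Equiv.swap_apply_def]; grind
    have h3 := hs.swap (p := a) (q := b) (by rw [ea, eb]; exact hab) hlt
    rw [ea, eb] at h3
    have v2a : (Equiv.swap (f a) (f b) ∘ f) a = f b := by simp
    have v2y : (Equiv.swap (f a) (f b) ∘ f) y = f y := by
      simp only [Function.comp, Equiv.swap_apply_def]; grind
    have v1y : (Equiv.swap (f y) (f y') ∘ f) y = f y' := by simp
    have v3a : (Equiv.swap (f a) (f b) ∘ (Equiv.swap (f y) (f y') ∘ f)) a = f b := by
      rw [Function.comp_apply, ea]; simp
    have v3y : (Equiv.swap (f a) (f b) ∘ (Equiv.swap (f y) (f y') ∘ f)) y = f y' := by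
      rw [Function.comp_apply, v1y, Equiv.swap_apply_def]; grind
    have := four_le_ncard_isLinExt hf hs h2 h3
      (fun h => by have := congrFun h y; omega) (fun h => by have := congrFun h a; omega)
      (fun h => by have := congrFun h a; omega) (fun h => by have := congrFun h a; omega)
      (fun h => by have := congrFun h a; omega) (fun h => by have := congrFun h y; omega)
    omega
  have chain : ∀ (k : ℕ) (a b : α), f b = f a + 1 + k → f b + 2 ≤ Fintype.card α → a < b := by
    intro k
    induction k with
    | zero => exact adj
    | succ k ih =>
      intro a b hab hb
      have := hf.2.2 b
      obtain ⟨c, hc⟩ := hf.exists_eq (i := f a + 1 + k) (by omega) (by omega)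
      exact (ih a c hc (by omega)).trans (adj c b (by omega) hb)
  have hch : ∀ a b, f a < f b → f b + 2 ≤ Fintype.card α → a < b :=
    fun a b hab hb => chain (f b - f a - 1) a b (by omega) hb
  refine ⟨hch, fun l hl => ?_⟩
  by_contra hly
  obtain ⟨u, hu⟩ := hf.exists_eq (i := Fintype.card α - 2) (by omega) (by omega)
  obtain ⟨v, hv⟩ := hf.exists_eq (i := Fintype.card α - 3) (by omega) (by omega)
  have hvy : ¬ v < y := by
    intro h
    by_cases hvl : f v = 2
    · rw [hf.2.1 (hvl.trans hl.symm)] at h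
      exact hly h
    · exact hly ((hch l v (by omega) (by omega)).trans h)
  have huy : ¬ u < y := fun h => hvy ((hch v u (by omega) (by omega)).trans h)
  have h2 := hf.swap (p := u) (q := y) (by omega) huy
  have e2y : (Equiv.swap (f u) (f y) ∘ f) y = f u := by simp
  have e2v : (Equiv.swap (f u) (f y) ∘ f) v = f v := by
    simp only [Function.comp, Equiv.swap_apply_def]; grind
  have h3 := h2.swap (p := v) (q := y) (by rw [e2y, e2v]; omega) hvy
  have v3y : (Equiv.swap ((Equiv.swap (f u) (f y) ∘ f) v) ((Equiv.swap (f u) (f y) ∘ f) y) ∘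
      (Equiv.swap (f u) (f y) ∘ f)) y = f v := by
    rw [Function.comp_apply, Equiv.swap_apply_right, e2v]
  have v1y : (Equiv.swap (f y) (f y') ∘ f) y = f y' := by simp
  have := four_le_ncard_isLinExt hf hs h2 h3
    (fun h => by have := congrFun h y; omega) (fun h => by have := congrFun h y; omega)
    (fun h => by have := congrFun h y; omega) (fun h => by have := congrFun h y; omega)
    (fun h => by have := congrFun h y; omega) (fun h => by have := congrFun h y; omega)
  omega

lemma exists_ne_isMin [Nonempty α] (h : ¬ ∃! a : α, IsMin a) :
    ∃ x y : α, IsMin x ∧ IsMin y ∧ x ≠ y := by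
  obtain ⟨x, hx⟩ := exists_minimal_of_wellFoundedLT (fun _ : α => True)
    ⟨Classical.arbitrary α, trivial⟩
  have hx' : IsMin x := fun b hb => hx.2 trivial hb
  by_contra hc
  push Not at hc
  exact h ⟨x, hx', fun y hy => hc y x hy hx'⟩

lemma exists_ne_isMax [Nonempty α] (h : ¬ ∃! a : α, IsMax a) :
    ∃ x y : α, IsMax x ∧ IsMax y ∧ x ≠ y := by
  obtain ⟨x, hx⟩ := exists_maximal_of_wellFoundedGT (fun _ : α => True)
    ⟨Classical.arbitrary α, trivial⟩
  have hx' : IsMax x := fun b hb => hx.2 trivial hb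
  by_contra hc
  push Not at hc
  exact h ⟨x, hx', fun y hy => hc y x hy hx'⟩

/-- If there are at most three linear extensions and at least two maximal elements, then all linear
extensions start with the same two elements. -/
lemma exists_common_first_two (hN : {f : α → ℕ | IsLinExt f}.ncard ≤ 3)
    (h5 : 5 ≤ Fintype.card α) (hmax : ¬ ∃! a : α, IsMax a) :
    ∃ l₁ l₂ : α, ∀ g : α → ℕ, IsLinExt g → g l₁ = 1 ∧ g l₂ = 2 := by
  have : Nonempty α := Fintype.card_pos_iff.1 (by omega)
  obtain ⟨y, y', hym, hym', hne⟩ := exists_ne_isMax hmax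
  obtain ⟨f, hf, hy, hy'⟩ := exists_isLinExt_last_two hym hym' hne
  obtain ⟨hch, hly⟩ := hf.chain_of_ncard_le_three hN h5 hy hy' hym.not_lt
  have hs := hf.swap (p := y) (q := y') (by omega) hym.not_lt
  obtain ⟨-, hly'⟩ := hs.chain_of_ncard_le_three hN h5 (y := y') (y' := y)
    (by simpa using hy) (by simpa using hy') hym'.not_lt
  obtain ⟨l₁, h1⟩ := hf.exists_eq (i := 1) (by omega) (by omega)
  obtain ⟨l₂, h2⟩ := hf.exists_eq (i := 2) (by omega) (by omega)
  have h12 : l₁ < l₂ := hch _ _ (by omega) (by omega)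
  have hall : ∀ a, a ≠ l₁ → a ≠ l₂ → l₂ < a := by
    intro a ha1 ha2
    have k1 : f a ≠ 1 := fun h => ha1 (hf.2.1 (h.trans h1.symm))
    have k2 : f a ≠ 2 := fun h => ha2 (hf.2.1 (h.trans h2.symm))
    have k3 := hf.2.2 a
    by_cases c1 : f a = Fintype.card α
    · rw [hf.2.1 (c1.trans hy'.symm)]
      apply hly'
      simp only [Function.comp, Equiv.swap_apply_def]
      grind
    by_cases c2 : f a + 1 = Fintype.card α
    · have : f a = f y := by omega
      rw [hf.2.1 this]
      exact hly _ h2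
    exact hch _ _ (by omega) (by omega)
  refine ⟨l₁, l₂, fun g hg => ?_⟩
  obtain ⟨a, ha⟩ := hg.exists_eq (i := 1) (by omega) (by omega)
  obtain ⟨b, hb⟩ := hg.exists_eq (i := 2) (by omega) (by omega)
  have g1 := hg.2.2 l₁
  have g2 := hg.2.2 l₂
  have g12 := hg.1 _ _ h12
  have e1 : a = l₁ := by
    by_contra hne1
    by_cases hne2 : a = l₂
    · subst hne2; omega
    · have := hg.1 _ _ (hall a hne1 hne2); omega
  subst e1
  refine ⟨ha, ?_⟩
  by_contra hne2
  have := hg.1 _ _ (hall b (by rintro rfl; omega) (by rintro rfl; omega))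
  omega

lemma ptnCount_onesWeight (ω : α → ℕ) :
    ptnCount ω (onesWeight (Fintype.card α)) = {f : α → ℕ | IsLinExt f}.ncard := by
  unfold ptnCount
  congr 1
  ext f
  simp only [Set.mem_ofPred_eq, onesWeight, Finsupp.onFinset_apply]
  constructor
  · rintro ⟨⟨h1, h2, -⟩, hw⟩
    have hinj : Function.Injective f := by
      intro a b hab
      have := hw (f a) (h1 a)
      have hle : (f ⁻¹' {f a}).ncard ≤ 1 := by split_ifs at this <;> omega
      exact (Set.ncard_le_one (Set.toFinite _)).1 hle a rfl b hab.symm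
    refine ⟨fun a b hab => lt_of_le_of_ne (h2 a b hab.le) fun h => hab.ne (hinj h), hinj,
      fun a => ⟨h1 a, ?_⟩⟩
    by_contra hc
    have := hw (f a) (h1 a)
    rw [if_neg (by tauto), Set.ncard_eq_zero] at this
    have ha : a ∈ f ⁻¹' {f a} := by simp
    rw [this] at ha
    exact ha
  · intro hf
    refine ⟨⟨fun a => (hf.2.2 a).1, fun a b hab => ?_, fun a b hab hω => ?_⟩, fun m hm => ?_⟩
    · rcases hab.eq_or_lt with rfl | h
      · rfl
      · exact (hf.1 _ _ h).le
    · exact hf.1 _ _ (lt_of_le_of_ne hab (by rintro rfl; omega))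
    · split_ifs with h
      · obtain ⟨a, ha⟩ := hf.exists_eq h.1 h.2
        rw [Set.ncard_eq_one]
        refine ⟨a, ?_⟩
        ext b
        simp only [Set.mem_preimage, Set.mem_singleton_iff]
        exact ⟨fun hb => hf.2.1 (hb.trans ha.symm), fun hb => hb ▸ ha⟩
      · rw [Set.ncard_eq_zero]
        ext b
        have := hf.2.2 b
        simp
        omega

/-- The linear extensions without a descent in the first position. -/
def firstAscents (ω : α → ℕ) : Set (α → ℕ) :=
  {f | IsLinExt f ∧ ∀ a b, f a = 1 → f b = 2 → ω a < ω b}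

lemma ptnCount_twoOnesWeight {ω : α → ℕ} (hω : Function.Injective ω)
    (h2 : 2 ≤ Fintype.card α) :
    ptnCount ω (twoOnesWeight (Fintype.card α)) = (firstAscents ω).ncard := by
  classical
  symm
  let ψ : (α → ℕ) → (α → ℕ) := fun f a => max (f a - 1) 1
  have hψ : ∀ f a, ψ f a = max (f a - 1) 1 := fun _ _ => rfl
  refine Set.BijOn.ncard_eq (f := ψ) ⟨?_, ?_, ?_⟩
  · rintro f ⟨hf, hA⟩
    obtain ⟨p, hp⟩ := hf.exists_eq (i := 1) (by omega) (by omega)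
    obtain ⟨q, hq⟩ := hf.exists_eq (i := 2) (by omega) (by omega)
    refine ⟨⟨fun a => by rw [hψ]; omega, fun a b hab => ?_, fun a b hab hlt => ?_⟩, fun m hm => ?_⟩
    · rcases hab.eq_or_lt with rfl | h
      · rfl
      · have := hf.1 _ _ h
        rw [hψ, hψ]
        omega
    · have hab' : a < b := lt_of_le_of_ne hab (by rintro rfl; omega)
      have h1 := hf.1 _ _ hab'
      have h3 := hf.2.2 a
      have h4 : ¬ (f a = 1 ∧ f b = 2) := fun h => by have := hA a b h.1 h.2; omega
      rw [hψ, hψ]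
      omega
    · simp only [twoOnesWeight, Finsupp.onFinset_apply]
      split_ifs with c1 c2
      · rw [Set.ncard_eq_two]
        refine ⟨p, q, by rintro rfl; omega, ?_⟩
        ext b
        have h3 := hf.2.2 b
        simp only [Set.mem_preimage, Set.mem_singleton_iff, Set.mem_insert_iff, hψ]
        constructor
        · intro hb
          have : f b = 1 ∨ f b = 2 := by omega
          exact this.imp (fun h => hf.2.1 (h.trans hp.symm)) (fun h => hf.2.1 (h.trans hq.symm))
        · rintro (rfl | rfl) <;> omega
      · obtain ⟨a, ha⟩ := hf.exists_eq (i := m + 1) (by omega) (by omega)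
        rw [Set.ncard_eq_one]
        refine ⟨a, ?_⟩
        ext b
        simp only [Set.mem_preimage, Set.mem_singleton_iff, hψ]
        constructor
        · intro hb
          exact hf.2.1 (by omega)
        · rintro rfl; omega
      · rw [Set.ncard_eq_zero]
        ext b
        have := hf.2.2 b
        simp only [Set.mem_preimage, Set.mem_singleton_iff, hψ, Set.mem_empty_iff_false, iff_false]
        omega
  · rintro f ⟨hf, hA⟩ g ⟨hg, hB⟩ hfg
    have key : ∀ a, max (f a - 1) 1 = max (g a - 1) 1 := fun a => congrFun hfg a
    obtain ⟨p, hp⟩ := hf.exists_eq (i := 1) (by omega) (by omega)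
    obtain ⟨q, hq⟩ := hf.exists_eq (i := 2) (by omega) (by omega)
    have hpq := hA p q hp hq
    have kp := key p
    have kq := key q
    have bp := hg.2.2 p
    have bq := hg.2.2 q
    have hne : g p ≠ g q := fun h => by rw [hg.2.1 h] at hpq; omega
    have hgp : g p = 1 ∧ g q = 2 := by
      by_contra hc
      have := hB q p (by omega) (by omega)
      omega
    funext a
    have ka := key a
    have ba := hf.2.2 a
    have ba' := hg.2.2 a
    by_cases c1 : f a = 1
    · rw [hf.2.1 (c1.trans hp.symm)]; omega
    by_cases c2 : f a = 2
    · rw [hf.2.1 (c2.trans hq.symm)]; omega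
    omega
  · rintro g ⟨⟨h1, hm, hs⟩, hw⟩
    simp only [twoOnesWeight, Finsupp.onFinset_apply] at hw
    have hw1 := hw 1 le_rfl
    rw [if_pos ⟨rfl, by omega⟩, Set.ncard_eq_two] at hw1
    have : ∃ p q, ω p < ω q ∧ g ⁻¹' {1} = {p, q} := by
      obtain ⟨p, q, hpq, heq⟩ := hw1
      rcases lt_or_gt_of_ne (fun h => hpq (hω h)) with h | h
      · exact ⟨p, q, h, heq⟩
      · exact ⟨q, p, h, by rw [heq, Set.pair_comm]⟩
    obtain ⟨p, q, hpq, heq⟩ := this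
    have hg1 : ∀ a, g a = 1 ↔ a = p ∨ a = q := fun a => by
      have : a ∈ g ⁻¹' {1} ↔ a ∈ ({p, q} : Set α) := by rw [heq]
      simpa using this
    have hginj : ∀ a b, g a = g b → g a ≠ 1 → a = b := by
      intro a b hab hne
      have := hw (g a) (h1 a)
      have hle : (g ⁻¹' {g a}).ncard ≤ 1 := by split_ifs at this <;> omega
      exact (Set.ncard_le_one (Set.toFinite _)).1 hle a rfl b hab.symm
    have hgle : ∀ a, g a + 1 ≤ Fintype.card α := by
      intro a
      by_contra hc
      have := hw (g a) (h1 a)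
      have h11 : g a ≠ 1 := by omega
      rw [if_neg (by tauto), if_neg (by tauto), Set.ncard_eq_zero] at this
      have ha : a ∈ g ⁻¹' {g a} := by simp
      rw [this] at ha
      exact ha
    have hqp : ¬ q < p := fun h => by
      have h3 := hs q p h.le hpq
      have h4 := (hg1 p).2 (Or.inl rfl)
      have h5 := h1 q
      omega
    have hgp := (hg1 p).2 (Or.inl rfl)
    have hgq := (hg1 q).2 (Or.inr rfl)
    have hpq' : p ≠ q := by rintro rfl; omega
    refine ⟨fun a => if a = p then 1 else g a + 1, ⟨⟨?_, ?_, ?_⟩, ?_⟩, ?_⟩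
    · intro a b hab
      have h3 := hm a b hab.le
      have h4 := h1 a
      have h5 := h1 b
      have hne := hab.ne
      by_cases hbp : b = p
      · subst hbp
        have ha : a = q := ((hg1 a).1 (by omega)).resolve_left hne
        subst ha
        exact absurd hab hqp
      · have h6 := hginj a b
        have h7 := hg1 a
        have h8 := hg1 b
        simp only [if_neg hbp]
        split_ifs with hap
        · omega
        · by_contra hc
          have e : g a = g b := by omega
          by_cases e1 : g a = 1
          · have ha := (h7.1 e1).resolve_left hap
            have hb := (h8.1 (e ▸ e1)).resolve_left hbp
            exact hne (ha.trans hb.symm)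
          · exact hne (h6 e e1)
    · intro a b hab
      have h4 := h1 a
      have h5 := h1 b
      have h6 := hginj a b
      have h7 := hg1 a
      have h8 := hg1 b
      grind
    · intro a
      have := hgle a
      dsimp only
      split_ifs <;> omega
    · intro a b ha hb
      have h4 := h1 a
      have h8 := hg1 b
      grind
    · funext a
      have h4 := h1 a
      change max ((if a = p then 1 else g a + 1) - 1) 1 = g a
      split_ifs with h
      · subst h; omega
      · omega

lemma firstAscents_eq_empty_or {ω : α → ℕ} {l₁ l₂ : α}
    (h : ∀ g : α → ℕ, IsLinExt g → g l₁ = 1 ∧ g l₂ = 2) :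
    firstAscents ω = ∅ ∨ firstAscents ω = {f | IsLinExt f} := by
  by_cases hl : ω l₁ < ω l₂
  · right
    refine Set.Subset.antisymm (fun f hf => hf.1) fun f hf => ⟨hf, fun a b ha hb => ?_⟩
    rwa [hf.2.1 (ha.trans (h f hf).1.symm), hf.2.1 (hb.trans (h f hf).2.symm)]
  · left
    refine Set.eq_empty_of_forall_notMem fun f hf => hl (hf.2 _ _ (h f hf.1).1 (h f hf.1).2)

lemma ncard_firstAscents_pos_and_lt [Nonempty α] {ω : α → ℕ} (hω : Function.Injective ω)
    (hmin : ¬ ∃! a : α, IsMin a) :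
    0 < (firstAscents ω).ncard ∧ (firstAscents ω).ncard < {f : α → ℕ | IsLinExt f}.ncard := by
  obtain ⟨x, y, hx, hy, hxy, hlt⟩ : ∃ x y : α, IsMin x ∧ IsMin y ∧ x ≠ y ∧ ω x < ω y := by
    obtain ⟨x, y, hx, hy, hne⟩ := exists_ne_isMin hmin
    rcases lt_or_gt_of_ne (fun h => hne (hω h)) with h | h
    · exact ⟨x, y, hx, hy, hne, h⟩
    · exact ⟨y, x, hy, hx, hne.symm, h⟩
  have hsub : firstAscents ω ⊆ {f : α → ℕ | IsLinExt f} := fun f hf => hf.1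
  constructor
  · rw [Set.ncard_pos (finite_setOf_isLinExt.subset hsub)]
    obtain ⟨f, hf, h1, h2⟩ := exists_isLinExt_first_two hx hy hxy
    refine ⟨f, hf, fun a b ha hb => ?_⟩
    rwa [hf.2.1 (ha.trans h1.symm), hf.2.1 (hb.trans h2.symm)]
  · obtain ⟨f, hf, h1, h2⟩ := exists_isLinExt_first_two hy hx hxy.symm
    refine Set.ncard_lt_ncard ⟨hsub, fun hc => ?_⟩ finite_setOf_isLinExt
    have := (hc hf).2 _ _ h1 h2
    omega

end LinExt

lemma IsLabeling.injective {α : Type*} {ω : α → ℕ} (hω : IsLabeling ω) :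
    Function.Injective ω :=
  fun _ _ h => hω.injOn (Set.mem_univ _) (Set.mem_univ _) h

/-- Equal generating functions exclude that the first poset has several minimal elements while the
second one has several maximal elements. -/
lemma KEq.existsUnique_isMin_or_isMax {α β : Type*} [PartialOrder α] [Fintype α]
    [PartialOrder β] [Fintype β] {ω : α → ℕ} {τ : β → ℕ} (hω : Function.Injective ω)
    (hτ : Function.Injective τ) (h : KEq ω τ) (hcard : Fintype.card α = Fintype.card β)
    (h5 : 5 ≤ Fintype.card α) (hN : {f : α → ℕ | IsLinExt f}.ncard ≤ 3) :
    (∃! a : α, IsMin a) ∨ ∃! b : β, IsMax b := by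
  by_contra! hc
  obtain ⟨hmin, hmax⟩ := hc
  have : Nonempty α := Fintype.card_pos_iff.1 (by omega)
  have e1 := h (onesWeight (Fintype.card α))
  have e2 := h (twoOnesWeight (Fintype.card α))
  rw [ptnCount_onesWeight, hcard, ptnCount_onesWeight] at e1
  rw [ptnCount_twoOnesWeight hω (by omega), hcard, ptnCount_twoOnesWeight hτ (by omega)] at e2
  obtain ⟨p1, p2⟩ := ncard_firstAscents_pos_and_lt hω hmin
  obtain ⟨l₁, l₂, hl⟩ := exists_common_first_two (α := β) (by omega) (by omega) hmax
  rcases firstAscents_eq_empty_or (ω := τ) hl with h0 | h0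
  · rw [h0, Set.ncard_empty] at e2
    omega
  · rw [h0] at e2
    omega

/-- Lemma 6.3: if `(P,ω) ~ (Q,τ)`, the underlying poset `P` has exactly 2 or exactly 3
linear extensions, and `|P| = |Q| ≥ 5`, then `P` and `Q` both have a unique minimal
element or both have a unique maximal element. -/
theorem stmt18 {α β : Type*} [PartialOrder α] [Fintype α] [PartialOrder β] [Fintype β]
    (ω : α → ℕ) (τ : β → ℕ) (hω : IsLabeling ω) (hτ : IsLabeling τ)
    (h : KEq ω τ)
    (hle : linExtCount α = 2 ∨ linExtCount α = 3)
    (hcard : Fintype.card α = Fintype.card β) (hcard5 : 5 ≤ Fintype.card α) :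
    ((∃! a : α, IsMin a) ∧ (∃! b : β, IsMin b)) ∨
    ((∃! a : α, IsMax a) ∧ (∃! b : β, IsMax b)) := by
  have hN : {f : α → ℕ | IsLinExt f}.ncard ≤ 3 := by
    have := ncard_setOf_isLinExt_le (α := α)
    omega
  have e1 := h (onesWeight (Fintype.card α))
  rw [ptnCount_onesWeight, hcard, ptnCount_onesWeight] at e1
  have h' : KEq τ ω := fun w => (h w).symm
  have hαα := KEq.existsUnique_isMin_or_isMax hω.injective hω.injective (fun _ => rfl) rfl hcard5 hN
  have hαβ := KEq.existsUnique_isMin_or_isMax hω.injective hτ.injective h hcard hcard5 hN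
  have hβα := KEq.existsUnique_isMin_or_isMax hτ.injective hω.injective h' hcard.symm
    (by omega) (by omega)
  have hββ := KEq.existsUnique_isMin_or_isMax hτ.injective hτ.injective (fun _ => rfl) rfl
    (by omega) (by omega)
  tauto
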